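/- arXiv:1009.0233 — 6 statements merged into one kernel-verified Lean document; each statement's English description precedes it below -/
import Mathlib

section
/- Let (σ, Λ) be a spectral pair and let ψ be a Schwartz function on ℝ. Then ∑_{λ∈Λ} | ∫_ℝ σ̂(y−λ) ψ(y) dy |² = ∫_ℝ |ψ̂(u)|² dσ(u). (This is the isometry property ‖Q_σ ψ‖²_{L²(ℝ,dx)} = ∫_ℝ |ψ̂|² dσ of the operator Q_σ, whose coefficients in the Hermite-function basis of L²(ℝ,dx) are the numbers ∫_ℝ σ̂(y−λ_n) ψ(y) dy.) -/
open MeasureTheory Complex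

/-- The Fourier transform of a positive measure: `σ̂(x) = ∫ e^{ixu} dσ(u)`. -/
noncomputable def fourierT (σ : Measure ℝ) (x : ℝ) : ℂ :=
  ∫ u, Complex.exp (Complex.I * x * u) ∂σ

/-- The Fourier transform of a function: `ψ̂(u) = ∫ e^{iux} ψ(x) dx`. -/
noncomputable def ft (ψ : ℝ → ℂ) (u : ℝ) : ℂ :=
  ∫ x : ℝ, Complex.exp (Complex.I * u * x) * ψ x

/-- `(σ, Λ)` is a spectral pair: the family `e_λ(u) = e^{iλu}`, `λ ∈ Λ`, forms a
Hilbert basis (complete orthonormal system) of `L²(σ)`. -/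
def IsSpectralPair (σ : Measure ℝ) (Λ : Set ℝ) : Prop :=
  ∃ b : HilbertBasis Λ ℂ (Lp ℂ 2 σ),
    ∀ l : Λ, (b l : ℝ → ℂ) =ᵐ[σ] fun u => Complex.exp (Complex.I * (l : ℝ) * u)

/-- Multiplying by a factor of modulus one preserves integrability on the product. -/
lemma integrable_exp_mul_prod (σ : Measure ℝ) [IsFiniteMeasure σ] (l : ℝ) {ψ : ℝ → ℂ}
    (hψ : Integrable ψ) :
    Integrable (fun p : ℝ × ℝ => exp (I * ((p.1 - l : ℝ) : ℂ) * p.2) * ψ p.1)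
      (volume.prod σ) := by
  refine Integrable.bdd_mul (c := 1) (hψ.comp_fst σ) ?_ (Filter.Eventually.of_forall fun p => ?_)
  · exact (by fun_prop : Continuous fun p : ℝ × ℝ =>
      exp (I * ((p.1 - l : ℝ) : ℂ) * p.2)).aestronglyMeasurable
  · rw [mul_assoc, mul_comm, ← ofReal_mul, norm_exp_ofReal_mul_I]

lemma continuous_ft {ψ : ℝ → ℂ} (hψ : Integrable ψ) : Continuous (ft ψ) := by
  refine continuous_of_dominated (bound := fun x => ‖ψ x‖) (fun u => ?_)
    (fun u => Filter.Eventually.of_forall fun x => ?_) hψ.norm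
    (Filter.Eventually.of_forall fun x => by fun_prop)
  · exact (by fun_prop : Continuous fun x : ℝ =>
      exp (I * u * x)).aestronglyMeasurable.mul hψ.aestronglyMeasurable
  · rw [norm_mul, mul_assoc, mul_comm I, ← ofReal_mul, norm_exp_ofReal_mul_I, one_mul]

lemma norm_ft_le (ψ : ℝ → ℂ) (u : ℝ) : ‖ft ψ u‖ ≤ ∫ x, ‖ψ x‖ := by
  refine (norm_integral_le_integral_norm _).trans_eq (integral_congr_ae ?_)
  refine Filter.Eventually.of_forall fun x => ?_
  simp only [norm_mul]
  rw [mul_assoc, mul_comm I, ← ofReal_mul, norm_exp_ofReal_mul_I, one_mul]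

lemma memLp_ft (σ : Measure ℝ) [IsFiniteMeasure σ] {ψ : ℝ → ℂ} (hψ : Integrable ψ) :
    MemLp (ft ψ) 2 σ :=
  MemLp.of_bound (continuous_ft hψ).aestronglyMeasurable _
    (Filter.Eventually.of_forall (norm_ft_le ψ))

lemma integral_fourierT_sub_mul (σ : Measure ℝ) [IsFiniteMeasure σ] (l : ℝ) {ψ : ℝ → ℂ}
    (hψ : Integrable ψ) :
    ∫ y : ℝ, fourierT σ (y - l) * ψ y = ∫ u, exp (-(I * l * u)) * ft ψ u ∂σ := by
  have hswap := integral_integral_swap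
    (f := fun y u : ℝ => exp (I * ((y - l : ℝ) : ℂ) * u) * ψ y) (integrable_exp_mul_prod σ l hψ)
  calc ∫ y : ℝ, fourierT σ (y - l) * ψ y
      = ∫ y : ℝ, ∫ u, exp (I * ((y - l : ℝ) : ℂ) * u) * ψ y ∂σ := by
        simp only [fourierT, integral_mul_const]
    _ = ∫ u : ℝ, (∫ y : ℝ, exp (I * ((y - l : ℝ) : ℂ) * u) * ψ y) ∂σ := hswap
    _ = ∫ u, exp (-(I * l * u)) * ft ψ u ∂σ := by
        refine integral_congr_ae (Filter.Eventually.of_forall fun u => ?_)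
        simp only [ft, ← integral_const_mul]
        refine integral_congr_ae (Filter.Eventually.of_forall fun y => ?_)
        simp only [← mul_assoc, ← exp_add]
        congr 2
        push_cast
        ring

/-- Parseval's identity for a Hilbert basis. -/
lemma HilbertBasis.hasSum_norm_inner_sq {ι 𝕜 E : Type*} [RCLike 𝕜] [NormedAddCommGroup E]
    [InnerProductSpace 𝕜 E] (b : HilbertBasis ι 𝕜 E) (x : E) :
    HasSum (fun i => ‖inner 𝕜 (b i) x‖ ^ 2) (‖x‖ ^ 2) := by
  have h := b.hasSum_inner_mul_inner x x
  rw [inner_self_eq_norm_sq_to_K] at h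
  refine (RCLike.hasSum_ofReal 𝕜).1 ?_
  push_cast
  refine h.congr_fun fun i => ?_
  rw [← inner_conj_symm x (b i), RCLike.conj_mul]

theorem stmt4 (σ : Measure ℝ) [IsFiniteMeasure σ] (Λ : Set ℝ) (hΛ : Λ.Countable)
    (h : IsSpectralPair σ Λ) (ψ : SchwartzMap ℝ ℂ) :
    ∑' l : Λ, ‖∫ y : ℝ, fourierT σ (y - (l : ℝ)) * ψ y‖ ^ 2
      = ∫ u, ‖ft (⇑ψ) u‖ ^ 2 ∂σ := by
  obtain ⟨b, hb⟩ := h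
  have hψ : Integrable ψ := ψ.integrable
  have hF := memLp_ft σ hψ
  have hcoeff (l : Λ) : ∫ y : ℝ, fourierT σ (y - (l : ℝ)) * ψ y
      = inner ℂ (b l) (hF.toLp (ft ψ)) := by
    rw [integral_fourierT_sub_mul σ l hψ, L2.inner_def]
    refine integral_congr_ae ?_
    filter_upwards [hb l, hF.coeFn_toLp] with u hu hFu
    rw [hu, hFu, RCLike.inner_apply, ← exp_conj, mul_comm]
    simp
  simp only [hcoeff]
  rw [(b.hasSum_norm_inner_sq _).tsum_eq, Lp.norm_toLp,
    hF.eLpNorm_eq_integral_rpow_norm two_ne_zero ENNReal.ofNat_ne_top,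
    ENNReal.toReal_ofReal (by positivity)]
  simp only [ENNReal.toReal_ofNat, Real.rpow_two]
  exact Real.rpow_inv_natCast_pow (n := 2) (by positivity) two_ne_zero
end

section
/- Let (σ, Λ) be a spectral pair. Then for all t, s ∈ ℝ, ∑_{λ∈Λ} ( ∫_0^t σ̂(y−λ) dy ) · conj( ∫_0^s σ̂(y−λ) dy ) = ∫_ℝ χ_t(u) · conj(χ_s(u)) dσ(u). (This identity expresses the covariance E[X_σ(t) X_σ(s)^*] = ⟨Q_σ 1_{[0,t]}, Q_σ 1_{[0,s]}⟩_{L²(ℝ,dx)} of the process X_σ(t) = ∑_λ (∫_0^t σ̂(y−λ) dy) Z_λ with i.i.d. standard Gaussians Z_λ.) -/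
open MeasureTheory Complex

/-- `χ_t(u) = (e^{itu} − 1)/u` for `u ≠ 0`, and `χ_t(0) = it`. -/
noncomputable def chi (t : ℝ) (u : ℝ) : ℂ :=
  if u = 0 then Complex.I * t else (Complex.exp (Complex.I * t * u) - 1) / u

/-- `χ_t` is `i` times the Fourier transform of the indicator function of `[0, t]`. -/
lemma I_mul_integral_exp_eq_chi (t u : ℝ) :
    I * (∫ y in (0 : ℝ)..t, exp (I * y * u)) = chi t u := by
  unfold chi
  split_ifs with hu
  · simp [hu]
  · have hu' : (u : ℂ) ≠ 0 := by exact_mod_cast hu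
    have hc : I * (u : ℂ) ≠ 0 := mul_ne_zero I_ne_zero hu'
    have hswap : (fun y : ℝ => exp (I * y * u)) = fun y : ℝ => exp (I * u * y) := by
      funext y
      ring_nf
    rw [hswap, integral_exp_mul_complex hc, ofReal_zero, mul_zero, exp_zero,
      mul_right_comm I (u : ℂ)]
    field_simp

lemma continuous_integral_exp (t : ℝ) :
    Continuous fun u : ℝ => ∫ y in (0 : ℝ)..t, exp (I * y * u) := by
  apply intervalIntegral.continuous_parametric_intervalIntegral_of_continuous'
  fun_prop

lemma norm_exp_I_mul_mul (y u : ℝ) : ‖exp (I * y * u)‖ = 1 := by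
  rw [mul_assoc, ← ofReal_mul, norm_exp_I_mul_ofReal]

lemma memLp_integral_exp (σ : Measure ℝ) [IsFiniteMeasure σ] (t : ℝ) :
    MemLp (fun u : ℝ => ∫ y in (0 : ℝ)..t, exp (I * y * u)) 2 σ := by
  refine MemLp.of_bound (continuous_integral_exp t).aestronglyMeasurable (1 * |t - 0|)
    (Filter.Eventually.of_forall fun u => ?_)
  exact intervalIntegral.norm_integral_le_of_norm_le_const fun y _ => (norm_exp_I_mul_mul y u).le

lemma conj_exp_I_mul_mul (l u : ℝ) :
    (starRingEnd ℂ) (exp (I * l * u)) = exp (-(I * l * u)) := by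
  simp [← exp_conj]

/-- The primitive of a translate of `σ̂` is a Fourier coefficient with respect to `σ`. -/
lemma integral_fourierT_sub (σ : Measure ℝ) [IsFiniteMeasure σ] (t l : ℝ) :
    ∫ y in (0 : ℝ)..t, fourierT σ (y - l)
      = ∫ u, (∫ y in (0 : ℝ)..t, exp (I * y * u)) * (starRingEnd ℂ) (exp (I * l * u)) ∂σ := by
  unfold fourierT
  rw [intervalIntegral_integral_swap]
  · refine integral_congr_ae (Filter.Eventually.of_forall fun u => ?_)
    simp only
    rw [← intervalIntegral.integral_mul_const]
    refine intervalIntegral.integral_congr fun y _ => ?_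
    rw [conj_exp_I_mul_mul, ← exp_add]
    push_cast
    ring_nf
  · have hfin : IsFiniteMeasure (volume.restrict (Set.uIoc 0 t)) :=
      ⟨by simp [Set.uIoc]⟩
    refine Integrable.of_bound (Continuous.aestronglyMeasurable ?_) 1
      (Filter.Eventually.of_forall fun p => (norm_exp_I_mul_mul _ _).le)
    unfold Function.uncurry
    fun_prop

theorem stmt10 (σ : Measure ℝ) [IsFiniteMeasure σ] (Λ : Set ℝ) (hΛ : Λ.Countable)
    (h : IsSpectralPair σ Λ) (t s : ℝ) :
    ∑' l : Λ,
        (∫ y in (0 : ℝ)..t, fourierT σ (y - (l : ℝ))) *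
          (starRingEnd ℂ) (∫ y in (0 : ℝ)..s, fourierT σ (y - (l : ℝ)))
      = ∫ u, chi t u * (starRingEnd ℂ) (chi s u) ∂σ := by
  obtain ⟨b, hb⟩ := h
  set F : ℝ → Lp ℂ 2 σ := fun t => (memLp_integral_exp σ t).toLp _ with hF
  have hFt (t : ℝ) : (F t : ℝ → ℂ) =ᵐ[σ] fun u => ∫ y in (0 : ℝ)..t, exp (I * y * u) :=
    (memLp_integral_exp σ t).coeFn_toLp
  have hcoef (t : ℝ) (l : Λ) :
      ∫ y in (0 : ℝ)..t, fourierT σ (y - (l : ℝ)) = inner ℂ (b l) (F t) := by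
    rw [integral_fourierT_sub, L2.inner_def]
    refine integral_congr_ae ?_
    filter_upwards [hFt t, hb l] with u hu hl
    rw [RCLike.inner_apply, hu, hl]
  have hinner : inner ℂ (F s) (F t) = ∫ u, chi t u * (starRingEnd ℂ) (chi s u) ∂σ := by
    rw [L2.inner_def]
    refine integral_congr_ae ?_
    filter_upwards [hFt t, hFt s] with u ht hs
    rw [RCLike.inner_apply, ht, hs, ← I_mul_integral_exp_eq_chi, ← I_mul_integral_exp_eq_chi,
      map_mul, conj_I, mul_mul_mul_comm, mul_neg, I_mul_I, neg_neg, one_mul]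
  rw [← hinner, ← b.tsum_inner_mul_inner]
  refine tsum_congr fun l => ?_
  rw [hcoef, hcoef, inner_conj_symm, mul_comm]
end

section
/- Let (σ, Λ) be a spectral pair. Then for all t, s ∈ ℝ, ∑_{λ∈Λ} | ∫_s^t σ̂(y−λ) dy |² ≤ (t−s)². (This is the Lipschitz bound ‖X_σ(t) − X_σ(s)‖_𝒲 ≤ |t−s| for the process X_σ(t) = ∑_λ (∫_0^t σ̂(y−λ) dy) Z_λ in the white noise space.) -/
open MeasureTheory Complex

theorem norm_exp_I_mul_ofReal_mul_ofReal (y u : ℝ) :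
    ‖Complex.exp (Complex.I * y * u)‖ = 1 := by
  rw [mul_assoc, ← Complex.ofReal_mul, mul_comm]
  exact Complex.norm_exp_ofReal_mul_I _

theorem continuous_intervalIntegral_exp (s t : ℝ) :
    Continuous fun u : ℝ => ∫ y in s..t, Complex.exp (Complex.I * y * u) :=
  intervalIntegral.continuous_parametric_intervalIntegral_of_continuous' (by fun_prop) s t

theorem norm_intervalIntegral_exp_le (s t u : ℝ) :
    ‖∫ y in s..t, Complex.exp (Complex.I * y * u)‖ ≤ |t - s| := by
  simpa using intervalIntegral.norm_integral_le_of_norm_le_const (a := s) (b := t) (C := 1)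
    fun y _ => (norm_exp_I_mul_ofReal_mul_ofReal y u).le

theorem memLp_intervalIntegral_exp (σ : Measure ℝ) [IsFiniteMeasure σ] (s t : ℝ) :
    MemLp (fun u : ℝ => ∫ y in s..t, Complex.exp (Complex.I * y * u)) 2 σ :=
  MemLp.of_bound (continuous_intervalIntegral_exp s t).aestronglyMeasurable |t - s|
    (ae_of_all _ (norm_intervalIntegral_exp_le s t))

theorem intervalIntegral_fourierT_sub (σ : Measure ℝ) [IsFiniteMeasure σ] (s t l : ℝ) :
    ∫ y in s..t, fourierT σ (y - l) =
      ∫ u, (∫ y in s..t, Complex.exp (Complex.I * y * u)) *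
        (starRingEnd ℂ) (Complex.exp (Complex.I * l * u)) ∂σ := by
  have : IsFiniteMeasure (volume.restrict (Set.uIoc s t)) := by
    unfold Set.uIoc
    infer_instance
  have hint : Integrable
      (Function.uncurry fun y u : ℝ => Complex.exp (Complex.I * (y - l : ℝ) * u))
      ((volume.restrict (Set.uIoc s t)).prod σ) := by
    refine Integrable.of_bound (C := 1) (Continuous.aestronglyMeasurable ?_)
      (ae_of_all _ fun p => (norm_exp_I_mul_ofReal_mul_ofReal _ _).le)
    unfold Function.uncurry
    fun_prop
  simp only [fourierT]
  rw [intervalIntegral_integral_swap hint]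
  refine integral_congr_ae (ae_of_all _ fun u => ?_)
  simp only
  rw [← intervalIntegral.integral_mul_const]
  congr 1 with y
  rw [← Complex.exp_conj, ← Complex.exp_add]
  simp
  ring_nf

theorem stmt11 (σ : Measure ℝ) [IsFiniteMeasure σ] (Λ : Set ℝ) (hΛ : Λ.Countable)
    (h : IsSpectralPair σ Λ) (t s : ℝ) :
    Summable (fun l : Λ => ‖∫ y in s..t, fourierT σ (y - (l : ℝ))‖ ^ 2) ∧
    ∑' l : Λ, ‖∫ y in s..t, fourierT σ (y - (l : ℝ))‖ ^ 2 ≤ (t - s) ^ 2 := by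
  obtain ⟨b, hb⟩ := h
  let f : Lp ℂ 2 σ := (memLp_intervalIntegral_exp σ s t).toLp _
  have hcoeff (l : Λ) : ∫ y in s..t, fourierT σ (y - (l : ℝ)) = inner ℂ (b l) f := by
    rw [intervalIntegral_fourierT_sub, L2.inner_def]
    refine integral_congr_ae ?_
    filter_upwards [hb l, (memLp_intervalIntegral_exp σ s t).coeFn_toLp] with u hu hfu
    rw [hu, hfu, RCLike.inner_apply]
  simp only [hcoeff]
  refine ⟨b.orthonormal.inner_products_summable f, ?_⟩
  rcases isEmpty_or_nonempty Λ with hempty | ⟨⟨l⟩⟩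
  · simpa using sq_nonneg (t - s)
  refine (b.orthonormal.tsum_inner_products_le f).trans ?_
  have hnorm : ‖f‖ ≤ |t - s| * ‖b l‖ := by
    refine Lp.norm_le_mul_norm_of_ae_le_mul ?_
    filter_upwards [hb l, (memLp_intervalIntegral_exp σ s t).coeFn_toLp] with u hu hfu
    rw [hu, hfu, norm_exp_I_mul_ofReal_mul_ofReal, mul_one]
    exact norm_intervalIntegral_exp_le s t u
  rw [b.orthonormal.norm_eq_one, mul_one] at hnorm
  exact sq_le_sq.2 (by rwa [abs_norm])
end

section
/- Let (σ, Λ) be a spectral pair with σ a probability measure. Then for all t, s ∈ ℝ, ∑_{λ∈Λ} | σ̂(t−λ) − σ̂(s−λ) |² = 2 (1 − Re σ̂(t−s)). In particular (taking t = s in the Parseval identity) ∑_{λ∈Λ} |σ̂(t−λ)|² = 1 for every t, so the derivative process W_σ(t) = ∑_λ σ̂(t−λ) Z_λ has constant variance 1 and is continuous in the white noise space norm. -/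
open MeasureTheory Complex

theorem memLp_exp_I_mul (σ : Measure ℝ) [IsFiniteMeasure σ] (t : ℝ) :
    MemLp (fun u : ℝ => Complex.exp (Complex.I * t * u)) 2 σ := by
  refine MemLp.of_bound (by fun_prop) 1 (.of_forall fun u => le_of_eq ?_)
  rw [show Complex.I * t * u = ((t * u : ℝ) : ℂ) * Complex.I by push_cast; ring]
  exact Complex.norm_exp_ofReal_mul_I _

/-- The function `u ↦ e^{itu}` as an element of `L²(σ)`. -/
noncomputable def expLp (σ : Measure ℝ) [IsFiniteMeasure σ] (t : ℝ) : Lp ℂ 2 σ :=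
  (memLp_exp_I_mul σ t).toLp

theorem inner_eq_fourierT {σ : Measure ℝ} {s t : ℝ} {f g : Lp ℂ 2 σ}
    (hf : f =ᵐ[σ] fun u => Complex.exp (Complex.I * s * u))
    (hg : g =ᵐ[σ] fun u => Complex.exp (Complex.I * t * u)) :
    inner ℂ f g = fourierT σ (t - s) := by
  rw [L2.inner_def, fourierT]
  refine integral_congr_ae ?_
  filter_upwards [hf, hg] with u hfu hgu
  rw [hfu, hgu, RCLike.inner_apply, ← Complex.exp_conj, ← Complex.exp_add]
  congr 1
  simp only [map_mul, Complex.conj_I, Complex.conj_ofReal]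
  push_cast
  ring

theorem fourierT_zero (σ : Measure ℝ) [IsProbabilityMeasure σ] : fourierT σ 0 = 1 := by
  simp [fourierT]

theorem norm_expLp_sq (σ : Measure ℝ) [IsProbabilityMeasure σ] (t : ℝ) :
    ‖expLp σ t‖ ^ 2 = 1 := by
  have h := (memLp_exp_I_mul σ t).coeFn_toLp
  rw [@norm_sq_eq_re_inner ℂ, expLp, inner_eq_fourierT h h, sub_self, fourierT_zero]
  simp

/-- Parseval's identity for a Hilbert basis. -/
theorem HilbertBasis.tsum_norm_inner_sq {ι E : Type*} [NormedAddCommGroup E]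
    [InnerProductSpace ℂ E] (b : HilbertBasis ι ℂ E) (x : E) :
    ∑' i, ‖inner ℂ (b i) x‖ ^ 2 = ‖x‖ ^ 2 := by
  have h := b.tsum_inner_mul_inner x x
  simp only [← inner_conj_symm x (b _), RCLike.conj_mul, inner_self_eq_norm_sq_to_K] at h
  exact_mod_cast h

theorem stmt13 (σ : Measure ℝ) [IsProbabilityMeasure σ]
    (Λ : Set ℝ) (hΛ : Λ.Countable) (h : IsSpectralPair σ Λ) :
    (∀ t s : ℝ,
      ∑' l : Λ, ‖fourierT σ (t - (l : ℝ)) - fourierT σ (s - (l : ℝ))‖ ^ 2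
        = 2 * (1 - (fourierT σ (t - s)).re)) ∧
    (∀ t : ℝ, ∑' l : Λ, ‖fourierT σ (t - (l : ℝ))‖ ^ 2 = 1) := by
  obtain ⟨b, hb⟩ := h
  have inner_basis (l : Λ) (t : ℝ) : inner ℂ (b l) (expLp σ t) = fourierT σ (t - l) :=
    inner_eq_fourierT (hb l) (memLp_exp_I_mul σ t).coeFn_toLp
  refine ⟨fun t s => ?_, fun t => ?_⟩
  · simp only [← inner_basis, ← inner_sub_right]
    have hts : inner ℂ (expLp σ s) (expLp σ t) = fourierT σ (t - s) :=
      inner_eq_fourierT (memLp_exp_I_mul σ s).coeFn_toLp (memLp_exp_I_mul σ t).coeFn_toLp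
    rw [b.tsum_norm_inner_sq, @norm_sub_sq ℂ, norm_expLp_sq, norm_expLp_sq, inner_re_symm, hts,
      RCLike.re_eq_complex_re]
    ring
  · simp only [← inner_basis]
    rw [b.tsum_norm_inner_sq, norm_expLp_sq]
end

section
/- Let θ > 0 and t ≥ 0. Then ∫_ℝ (1 − cos(tu))/(θ² + u²) du = (π/θ)(1 − e^{−θ t}). Consequently, with dσ(u) = (α²/(2π)) · u²/(θ² + u²) du for α > 0, one has ∫_ℝ (1 − cos(tu))/u² dσ(u) = (α²/(2θ))(1 − e^{−θ t}); this exhibits an absolutely continuous spectral measure for the centered Ornstein–Uhlenbeck process, which is a stationary increment Gaussian process. -/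
open MeasureTheory

/-- The two-sided exponential `exp (-θ |x|)`, multiplied by a character, is integrable with explicit
integral. -/
theorem integrable_and_integral_exp_mul_I_sub_mul_abs {θ : ℝ} (hθ : 0 < θ) (s : ℝ) :
    Integrable (fun x : ℝ => Complex.exp (s * Complex.I * x - θ * (|x| : ℝ))) ∧
      ∫ x : ℝ, Complex.exp (s * Complex.I * x - θ * (|x| : ℝ))
        = ((2 * θ / (θ ^ 2 + s ^ 2) : ℝ) : ℂ) := by
  have hneg : (s * Complex.I - θ : ℂ).re < 0 := by simpa
  have hpos : 0 < (s * Complex.I + θ : ℂ).re := by simpa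
  have eqIoi : Set.EqOn (fun x : ℝ => Complex.exp ((s * Complex.I - θ) * x))
      (fun x : ℝ => Complex.exp (s * Complex.I * x - θ * (|x| : ℝ))) (Set.Ioi 0) := by
    intro x hx
    simp only [abs_of_pos (Set.mem_Ioi.1 hx), sub_mul]
  have eqIic : Set.EqOn (fun x : ℝ => Complex.exp ((s * Complex.I + θ) * x))
      (fun x : ℝ => Complex.exp (s * Complex.I * x - θ * (|x| : ℝ))) (Set.Iic 0) := by
    intro x hx
    simp only [abs_of_nonpos (Set.mem_Iic.1 hx), Complex.ofReal_neg]
    ring_nf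
  have intIoi := (integrableOn_exp_mul_complex_Ioi hneg 0).congr_fun eqIoi measurableSet_Ioi
  have intIic := (integrableOn_exp_mul_complex_Iic hpos 0).congr_fun eqIic measurableSet_Iic
  refine ⟨?_, ?_⟩
  · rw [← integrableOn_univ, ← Set.Iic_union_Ioi (a := (0 : ℝ))]
    exact intIic.union intIoi
  · rw [← intervalIntegral.integral_Iic_add_Ioi intIic intIoi,
      ← setIntegral_congr_fun measurableSet_Ioi eqIoi,
      ← setIntegral_congr_fun measurableSet_Iic eqIic,
      integral_exp_mul_complex_Ioi hneg, integral_exp_mul_complex_Iic hpos]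
    have h1 : (s * Complex.I - θ : ℂ) ≠ 0 := fun h => by simp [h] at hneg
    have h2 : (s * Complex.I + θ : ℂ) ≠ 0 := fun h => by simp [h] at hpos
    have h3 : (θ ^ 2 + s ^ 2 : ℂ) ≠ 0 := by
      exact_mod_cast (by positivity : θ ^ 2 + s ^ 2 ≠ 0)
    push_cast
    simp only [mul_zero, Complex.exp_zero]
    field_simp
    linear_combination (-2 * θ * s ^ 2 : ℂ) * Complex.I_sq

theorem integrable_inv_sq_add_sq {θ : ℝ} (hθ : 0 < θ) :
    Integrable (fun u : ℝ => (θ ^ 2 + u ^ 2)⁻¹) := by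
  have h := (integrable_inv_one_add_sq.comp_mul_left' (inv_ne_zero hθ.ne')).const_mul (θ ^ 2)⁻¹
  refine h.congr (ae_of_all _ fun u => ?_)
  simp only
  rw [← mul_inv]
  congr 1
  field_simp

open FourierTransform in
theorem fourier_exp_neg_mul_abs {θ : ℝ} (hθ : 0 < θ) :
    𝓕 (fun x : ℝ => Complex.exp (-θ * (|x| : ℝ)))
      = fun w : ℝ => ((2 * θ / (θ ^ 2 + (2 * Real.pi * w) ^ 2) : ℝ) : ℂ) := by
  ext w
  rw [Real.fourier_real_eq_integral_exp_smul]
  have h := (integrable_and_integral_exp_mul_I_sub_mul_abs hθ (-(2 * Real.pi * w))).2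
  rw [neg_sq] at h
  rw [← h]
  congr 1 with x
  rw [smul_eq_mul, ← Complex.exp_add]
  congr 1
  push_cast
  ring

open FourierTransform in
theorem integral_cos_mul_div_sq_add_sq {θ : ℝ} (hθ : 0 < θ) (t : ℝ) :
    ∫ u : ℝ, Real.cos (t * u) / (θ ^ 2 + u ^ 2) = Real.pi / θ * Real.exp (-θ * |t|) := by
  have hf : Integrable (fun x : ℝ => Complex.exp (-θ * (|x| : ℝ))) := by
    simpa [neg_mul] using (integrable_and_integral_exp_mul_I_sub_mul_abs hθ 0).1
  have hg : Integrable
      (fun w : ℝ => ((2 * θ / (θ ^ 2 + (2 * Real.pi * w) ^ 2) : ℝ) : ℂ)) := by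
    have h : Integrable (fun w : ℝ => 2 * θ / (θ ^ 2 + (2 * Real.pi * w) ^ 2)) := by
      simpa only [div_eq_mul_inv] using
        ((integrable_inv_sq_add_sq hθ).comp_mul_left' (R := 2 * Real.pi)
          (by positivity)).const_mul (2 * θ)
    exact h.ofReal
  have hinv := congrFun (Continuous.fourierInv_fourier_eq
    (f := fun x : ℝ => Complex.exp (-θ * (|x| : ℝ))) (by fun_prop) hf
    (by rwa [fourier_exp_neg_mul_abs hθ])) t
  rw [fourier_exp_neg_mul_abs hθ, Real.fourierInv_eq'] at hinv
  have hre := congrArg Complex.re hinv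
  have hint : Integrable (fun w : ℝ => Complex.exp (↑(2 * Real.pi * inner ℝ w t) * Complex.I) •
      ((2 * θ / (θ ^ 2 + (2 * Real.pi * w) ^ 2) : ℝ) : ℂ)) := by
    refine hg.bdd_mul (c := 1) (by fun_prop) (ae_of_all _ fun w => ?_)
    rw [Complex.norm_exp_ofReal_mul_I]
  have hre' : ∫ w : ℝ, 2 * θ * (Real.cos (t * (2 * Real.pi * w)) /
      (θ ^ 2 + (2 * Real.pi * w) ^ 2)) = Real.exp (-θ * |t|) := by
    rw [← RCLike.re_to_complex, ← integral_re hint] at hre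
    calc _ = _ := by
          refine integral_congr_ae (ae_of_all _ fun w => ?_)
          simp only [smul_eq_mul, RCLike.re_to_complex, Complex.re_mul_ofReal,
            Complex.exp_ofReal_mul_I_re]
          rw [show 2 * Real.pi * inner ℝ w t = t * (2 * Real.pi * w) by simp; ring]
          ring
      _ = _ := hre
      _ = _ := by
          rw [← Complex.ofReal_neg, ← Complex.ofReal_mul, Complex.exp_ofReal_re]
  rw [integral_const_mul, Measure.integral_comp_mul_left
    (fun u => Real.cos (t * u) / (θ ^ 2 + u ^ 2)) (2 * Real.pi),
    abs_of_pos (by positivity), smul_eq_mul] at hre'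
  rw [← hre']
  field_simp

theorem integral_one_sub_cos_mul_div_sq_add_sq {θ : ℝ} (hθ : 0 < θ) (t : ℝ) :
    ∫ u : ℝ, (1 - Real.cos (t * u)) / (θ ^ 2 + u ^ 2)
      = Real.pi / θ * (1 - Real.exp (-θ * |t|)) := by
  have h0 := integral_cos_mul_div_sq_add_sq hθ 0
  simp only [zero_mul, Real.cos_zero, abs_zero, mul_zero, Real.exp_zero, one_div] at h0
  simp only [sub_div, one_div]
  rw [integral_sub (integrable_inv_sq_add_sq hθ), h0, integral_cos_mul_div_sq_add_sq hθ]
  · ring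
  · refine (integrable_inv_sq_add_sq hθ).bdd_mul (c := 1) (by fun_prop)
      (ae_of_all _ fun u => ?_)
    exact Real.abs_cos_le_one _

theorem stmt15 (θ : ℝ) (hθ : 0 < θ) (t : ℝ) (ht : 0 ≤ t) (α : ℝ) (hα : 0 < α) :
    (∫ u : ℝ, (1 - Real.cos (t * u)) / (θ ^ 2 + u ^ 2))
        = Real.pi / θ * (1 - Real.exp (-θ * t)) ∧
    (∫ u : ℝ, (if u = 0 then t ^ 2 / 2 else (1 - Real.cos (t * u)) / u ^ 2) *
        (α ^ 2 / (2 * Real.pi) * (u ^ 2 / (θ ^ 2 + u ^ 2))))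
        = α ^ 2 / (2 * θ) * (1 - Real.exp (-θ * t)) := by
  have key := integral_one_sub_cos_mul_div_sq_add_sq hθ t
  rw [abs_of_nonneg ht] at key
  refine ⟨key, ?_⟩
  have hcongr (u : ℝ) : (if u = 0 then t ^ 2 / 2 else (1 - Real.cos (t * u)) / u ^ 2) *
      (α ^ 2 / (2 * Real.pi) * (u ^ 2 / (θ ^ 2 + u ^ 2)))
      = α ^ 2 / (2 * Real.pi) * ((1 - Real.cos (t * u)) / (θ ^ 2 + u ^ 2)) := by
    split_ifs with hu
    · simp [hu]
    · field_simp
  simp only [hcongr]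
  rw [integral_const_mul, key]
  field_simp
end

section
/- Let σ be a positive Borel measure on ℝ with ∫_ℝ dσ(u)/(1+u²) < ∞, and define r : ℝ → ℂ by r(t) = −∫_ℝ G(t,u) dσ(u), where G(t,u) = (e^{itu} − 1 − itu/(u²+1))/u² for u ≠ 0 and G(t,0) = −t²/2 (the limiting value). Then for all t, s ∈ ℝ, K_σ(t,s) := ∫_ℝ χ_t(u) · conj(χ_s(u)) dσ(u) = r(t) + conj(r(s)) − r(t−s). -/
open MeasureTheory Complex

/-- `G(t,u) = (e^{itu} − 1 − itu/(u²+1))/u²` for `u ≠ 0`, `G(t,0) = −t²/2`. -/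
noncomputable def Gfun (t u : ℝ) : ℂ :=
  if u = 0 then ((-(t ^ 2) / 2 : ℝ) : ℂ)
  else (Complex.exp (Complex.I * t * u) - 1 - Complex.I * t * u / ((u : ℂ) ^ 2 + 1)) /
    ((u : ℂ) ^ 2)

theorem norm_exp_I_mul_sub_one_sub_le (x : ℝ) :
    ‖exp (I * x) - 1 - I * x‖ ≤ 2 * x ^ 2 := by
  have hn : ‖I * (x : ℂ)‖ = |x| := by simp
  rcases le_total |x| 1 with h | h
  · have := norm_exp_sub_one_sub_id_le (hn.trans_le h)
    rw [hn, sq_abs] at this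
    nlinarith [sq_nonneg x]
  · have h1 : ‖exp (I * x) - 1‖ ≤ |x| := Real.norm_exp_I_mul_ofReal_sub_one_le
    have h2 := norm_sub_le (exp (I * x) - 1) (I * x)
    rw [hn] at h2
    nlinarith [sq_abs x]

theorem norm_Gfun_le (t u : ℝ) :
    ‖Gfun t u‖ ≤ (2 * t ^ 2 + 2 * |t| + 2) * (1 / (1 + u ^ 2)) := by
  have ht := abs_nonneg t
  unfold Gfun
  split_ifs with hu
  · rw [norm_real, Real.norm_eq_abs, abs_div, abs_neg, abs_of_nonneg (sq_nonneg t), hu]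
    norm_num
    nlinarith [sq_nonneg t]
  set N : ℂ := exp (I * t * u) - 1 - I * t * u / ((u : ℂ) ^ 2 + 1) with hN
  have hu2 : 0 < u ^ 2 := by positivity
  have hd : (0 : ℝ) < u ^ 2 + 1 := by positivity
  have hdc : (u : ℂ) ^ 2 + 1 ≠ 0 := by exact_mod_cast hd.ne'
  have hx : I * (t : ℂ) * u = I * ((t * u : ℝ) : ℂ) := by push_cast; ring
  have hu1 : |u| / (u ^ 2 + 1) ≤ 1 := by
    rw [div_le_one hd]
    nlinarith [sq_abs u, sq_nonneg (|u| - 1)]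
  have hc : ‖I * (t : ℂ) * u / ((u : ℂ) ^ 2 + 1)‖ ≤ |t| := by
    have h : ‖(u : ℂ) ^ 2 + 1‖ = u ^ 2 + 1 := by
      rw [show (u : ℂ) ^ 2 + 1 = ((u ^ 2 + 1 : ℝ) : ℂ) by push_cast; ring, norm_real,
        Real.norm_of_nonneg hd.le]
    rw [norm_div, h, norm_mul, norm_mul, norm_I, norm_real, norm_real, one_mul,
      Real.norm_eq_abs, Real.norm_eq_abs, mul_div_assoc]
    exact mul_le_of_le_one_right ht hu1
  have large : ‖N‖ ≤ 2 + |t| := by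
    have h1 : ‖exp (I * t * u)‖ = 1 := by
      rw [hx, mul_comm, norm_exp_ofReal_mul_I]
    have h2 := norm_sub_le (exp (I * t * u)) 1
    rw [h1, norm_one] at h2
    have h3 := norm_sub_le (exp (I * t * u) - 1) (I * t * u / ((u : ℂ) ^ 2 + 1))
    linarith
  have small : ‖N‖ ≤ (2 * t ^ 2 + |t|) * u ^ 2 := by
    have h0 : N = (exp (I * t * u) - 1 - I * t * u)
        + I * t * u / ((u : ℂ) ^ 2 + 1) * ((u ^ 2 : ℝ) : ℂ) := by
      rw [hN]
      push_cast
      field_simp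
      ring
    have h1 := norm_exp_I_mul_sub_one_sub_le (t * u)
    rw [← hx] at h1
    have h2 : ‖I * t * u / ((u : ℂ) ^ 2 + 1) * ((u ^ 2 : ℝ) : ℂ)‖ ≤ |t| * u ^ 2 := by
      rw [norm_mul, norm_real, Real.norm_of_nonneg hu2.le]
      gcongr
    rw [h0]
    refine (norm_add_le _ _).trans ?_
    linarith [mul_pow t u 2]
  have hden : ‖(u : ℂ) ^ 2‖ = u ^ 2 := by
    rw [norm_pow, norm_real, Real.norm_eq_abs, sq_abs]
  rw [norm_div, hden, mul_one_div, div_le_div_iff₀ hu2 (by linarith)]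
  nlinarith [mul_le_mul_of_nonneg_right large hu2.le]

theorem measurable_Gfun (t : ℝ) : Measurable (Gfun t) := by
  unfold Gfun
  exact Measurable.ite (measurableSet_singleton 0) measurable_const (by fun_prop)

theorem integrable_Gfun {σ : Measure ℝ}
    (hK : Integrable (fun u : ℝ => 1 / (1 + u ^ 2)) σ) (t : ℝ) : Integrable (Gfun t) σ :=
  (hK.const_mul _).mono' (measurable_Gfun t).aestronglyMeasurable
    (Filter.Eventually.of_forall (norm_Gfun_le t))

theorem chi_mul_conj_chi (t s u : ℝ) :
    chi t u * (starRingEnd ℂ) (chi s u)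
      = Gfun (t - s) u - Gfun t u - (starRingEnd ℂ) (Gfun s u) := by
  by_cases hu : u = 0
  · simp only [chi, Gfun, hu, if_true, map_mul, conj_I, conj_ofReal]
    push_cast
    linear_combination (-(t : ℂ) * s) * I_sq
  · have huc : (u : ℂ) ≠ 0 := ofReal_ne_zero.mpr hu
    have hdc : (u : ℂ) ^ 2 + 1 ≠ 0 := by
      have : u ^ 2 + 1 ≠ 0 := by positivity
      exact_mod_cast this
    have he : exp (I * ((t - s : ℝ) : ℂ) * u) = exp (I * t * u) * exp (-I * s * u) := by
      rw [← exp_add]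
      congr 1
      push_cast
      ring
    simp only [chi, Gfun, hu, if_false, map_mul, map_div₀, map_sub, map_add, map_pow, map_one,
      conj_I, conj_ofReal, ← exp_conj, he]
    push_cast
    field_simp
    ring

theorem stmt18 (σ : Measure ℝ)
    (hK : Integrable (fun u : ℝ => 1 / (1 + u ^ 2)) σ) (t s : ℝ) :
    ∫ u, chi t u * (starRingEnd ℂ) (chi s u) ∂σ
      = (-∫ u, Gfun t u ∂σ) + (starRingEnd ℂ) (-∫ u, Gfun s u ∂σ)
        - (-∫ u, Gfun (t - s) u ∂σ) := by
  have hG := integrable_Gfun hK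
  have hsub : Integrable (fun u => Gfun (t - s) u - Gfun t u) σ := (hG (t - s)).sub (hG t)
  have hconj : Integrable (fun u => (starRingEnd ℂ) (Gfun s u)) σ :=
    conjCLE.toContinuousLinearMap.integrable_comp (hG s)
  simp_rw [chi_mul_conj_chi]
  rw [integral_sub hsub hconj, integral_sub (hG (t - s)) (hG t),
    integral_conj, map_neg]
  ring
end
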